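/- (Permutation move, k = d = 2.) Fix ℓ ≥ 3 and a permutation σ of the sites [2,ℓ]², extended by the identity outside [2,ℓ]². Let M be the set of configurations η for which the box [ℓ]² is framed (its first row and first column are entirely empty) and [2,ℓ]² contains at least one empty site. There exists a T-step move M with domain Dom(M) = {(η,z) : η ∈ M, η(z) = 1}, with transitions contained in [ℓ]², such that for every (η,z) ∈ Dom(M) the final configuration satisfies (M_T η)(σx) = η(x) for all x ∈ [2,ℓ]², M_T η agrees with η outside [ℓ]², and the tracked particle ends at z_T = σz. -/

import Mathlib

open MeasureTheory ENNReal

noncomputable section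

namespace KA

open scoped Classical

/-- Sites of the lattice `ℤ^d`. -/
abbrev Site (d : ℕ) := Fin d → ℤ

/-- A configuration: `true` = occupied, `false` = empty. -/
abbrev Config (d : ℕ) := Site d → Bool

variable {d : ℕ}

def origin : Site d := fun _ => 0

def eVec (d : ℕ) (i : Fin d) : Site d := fun j => if j = i then 1 else 0

/-- Nearest neighbours in `ℤ^d`. -/
def adj (x y : Site d) : Prop := (∑ i, |x i - y i|) = 1

/-- The set of (at most `2d`) nearest neighbours of a site. -/
def neighbors (x : Site d) : Finset (Site d) :=
  Finset.image (fun p : Fin d × Bool =>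
    Function.update x p.1 (x p.1 + if p.2 then 1 else -1)) Finset.univ

/-- The Kob-Andersen kinetic constraint `c_{xy}` for parameter `k`:
`x` has at least `k-1` empty neighbours other than `y`, and vice versa. -/
def constraint (k : ℕ) (η : Config d) (x y : Site d) : Prop :=
  k - 1 ≤ ((neighbors x).filter fun z => z ≠ y ∧ η z = false).card ∧
  k - 1 ≤ ((neighbors y).filter fun z => z ≠ x ∧ η z = false).card

/-- `c_{xy}(η)` as a `{0,1}`-valued quantity. -/
def cval (k : ℕ) (η : Config d) (x y : Site d) : ℝ≥0∞ :=
  if constraint k η x y then 1 else 0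

/-- `η^{xy}` : the configuration with the values at `x` and `y` exchanged. -/
def swap (η : Config d) (x y : Site d) : Config d :=
  fun z => if z = x then η y else if z = y then η x else η z

/-- `(τ_y η)(z) = η (z - y)`. -/
def shift (y : Site d) (η : Config d) : Config d := fun z => η (z - y)

/-- A local function depends on finitely many coordinates. -/
def IsLocal (f : Config d → ℝ) : Prop :=
  ∃ S : Finset (Site d), ∀ η η' : Config d, (∀ x ∈ S, η x = η' x) → f η = f η'

def dotZ (u : Fin d → ℝ) (y : Site d) : ℝ := ∑ i, u i * (y i : ℝ)

/-- The environment part `Σ_{x ≠ 0} Σ_{y ∼ x} c_{xy} (f(η^{xy}) - f(η))²`. -/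
def envTerm (k : ℕ) (f : Config d → ℝ) (η : Config d) : ℝ≥0∞ :=
  ∑' p : Site d × Site d,
    if p.1 ≠ origin ∧ adj p.1 p.2 then
      cval k η p.1 p.2 * ENNReal.ofReal ((f (swap η p.1 p.2) - f η) ^ 2)
    else 0

/-- The tagged-particle part `Σ_{y ∼ 0} c_{0y} (u·y + f(τ_y η^{0y}) - f(η))²`. -/
def tagTerm (k : ℕ) (u : Fin d → ℝ) (f : Config d → ℝ) (η : Config d) : ℝ≥0∞ :=
  ∑' y : Site d,
    if adj origin y then
      cval k η origin y *
        ENNReal.ofReal ((dotZ u y + f (shift y (swap η origin y)) - f η) ^ 2)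
    else 0

/-- The variational (Dirichlet) functional `E_u(f)` integrated against `μ₀`. -/
def energy (k : ℕ) (u : Fin d → ℝ) (μ0 : Measure (Config d)) (f : Config d → ℝ) : ℝ≥0∞ :=
  ∫⁻ η, envTerm k f η + tagTerm k u f η ∂μ0

/-- `μ` is the Bernoulli product measure where each site is independently
occupied with probability `1 - q`. -/
def IsBernoulliProduct (q : ℝ) (μ : Measure (Config d)) : Prop :=
  IsProbabilityMeasure μ ∧
  ∀ (S : Finset (Site d)) (ζ : Site d → Bool),
    μ {η | ∀ x ∈ S, η x = ζ x} = ∏ x ∈ S, ENNReal.ofReal (if ζ x then 1 - q else q)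

/-- `μ₀ = μ(· | η(0) = 1)`. -/
def condOcc (μ : Measure (Config d)) : Measure (Config d) :=
  ProbabilityTheory.cond μ {η | η origin = true}

/-- The first standard basis vector of `ℝ^d`. -/
def e1R (d : ℕ) : Fin d → ℝ := fun i => if (i : ℕ) = 0 then 1 else 0

def basisR (d : ℕ) (i : Fin d) : Fin d → ℝ := fun j => if j = i then 1 else 0

/-- The quadratic form `u ↦ inf over local f of E_u(f)`. -/
def Qform (k : ℕ) (μ : Measure (Config d)) (u : Fin d → ℝ) : ℝ≥0∞ :=
  ⨅ f : {f : Config d → ℝ // IsLocal f}, energy k u (condOcc μ) f.1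

/-- The self-diffusion coefficient `D(q) = inf_f E_{e₁}(f)`. -/
def diffCoeff (k : ℕ) (μ : Measure (Config d)) : ℝ≥0∞ := Qform k μ (e1R d)

/-- `expIter n` is the `n`-fold iterated exponential. -/
def expIter : ℕ → ℝ → ℝ
  | 0, x => x
  | n + 1, x => Real.exp (expIter n x)

/-! ### Frameability, goodness, block-connectedness -/

/-- Fill every site outside `V` with a particle. -/
def fillOutside (V : Set (Site d)) (η : Config d) : Config d :=
  fun z => if z ∈ V then η z else true

/-- A single legal KA-`k`f transition inside `V`. -/
def KAStep (k : ℕ) (V : Set (Site d)) (η η' : Config d) : Prop :=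
  ∃ x y, adj x y ∧ x ∈ V ∧ y ∈ V ∧ η x ≠ η y ∧ constraint k η x y ∧ η' = swap η x y

/-- A generalized box with minimal corner `a`, spanning the directions in `E`,
with side length `m` (coordinates outside `E` are frozen at `a`). -/
def genBox (a : Site d) (E : Finset (Fin d)) (m : ℕ) : Set (Site d) :=
  {x | ∀ i, (i ∈ E → a i ≤ x i ∧ x i < a i + m) ∧ (i ∉ E → x i = a i)}

/-- The `k'`-th frame of the generalized box: the union of all of its
`(k'-1)`-dimensional slices passing through the minimal corner. -/
def genFrame (k' : ℕ) (a : Site d) (E : Finset (Fin d)) (m : ℕ) : Set (Site d) :=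
  {x | x ∈ genBox a E m ∧ (E.filter fun i => x i ≠ a i).card ≤ k' - 1}

/-- The generalized box is frameable for `η` : `η` (with the outside filled by
particles) is connected by legal KA-`k'`f transitions inside the box to a
configuration whose `k'`-th frame is empty. -/
def Frameable (k' : ℕ) (a : Site d) (E : Finset (Fin d)) (m : ℕ) (η : Config d) : Prop :=
  ∃ η', Relation.ReflTransGen (KAStep k' (genBox a E m)) (fillOutside (genBox a E m) η) η' ∧
    ∀ x ∈ genFrame k' a E m, η' x = false

def one (d : ℕ) : Site d := fun _ => 1

/-- minimal corner of the box `b + [m]^d`. -/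
def corner (b : Site d) : Site d := fun i => b i + 1

/-- All codimension-one slices of the generalized box are `(k'-1)`-frameable,
for every configuration differing from `η` in at most one site. -/
def SlicesOK (k' : ℕ) (a : Site d) (E : Finset (Fin d)) (m : ℕ) (η : Config d) : Prop :=
  ∀ η' : Config d, {x | η' x ≠ η x}.Subsingleton →
    ∀ i ∈ E, ∀ t : ℕ, t < m →
      Frameable (k' - 1) (Function.update a i (a i + t)) (E.erase i) m η'

/-- A good box: all codimension-one slices frameable (robustly to one spin flip),
with one extra empty site in addition to the ones required. -/
def GoodBox (k' : ℕ) (a : Site d) (E : Finset (Fin d)) (m : ℕ) (η : Config d) : Prop :=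
  SlicesOK k' a E m η ∧
  ∃ x₀ ∈ genBox a E m, η x₀ = false ∧ SlicesOK k' a E m (Function.update η x₀ true)

/-- The length scale `ℓ = ℓ(q)`. -/
def lscale (d k : ℕ) (c q : ℝ) : ℕ :=
  if k = 2 then ⌈c * Real.log (1 / q) * q ^ (-(1 : ℝ) / ((d : ℝ) - 1))⌉₊
  else ⌈c * expIter (k - 2) (q ^ (-(1 : ℝ) / ((d : ℝ) - (k : ℝ) + 1)))⌉₊

/-- The length scale `L = q^{-cℓ}`. -/
def Lscale (q c : ℝ) (ℓ : ℕ) : ℕ := ⌈q ^ (-(c * (ℓ : ℝ)))⌉₊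

/-- One step between adjacent boxes: the base point moves by `±ℓ e_i`. -/
def pathStep (ℓ : ℕ) (b b' : Site d) : Prop :=
  ∃ i : Fin d, ∃ s : Bool,
    b' = fun j => b j + if j = i then (if s then (ℓ : ℤ) else -(ℓ : ℤ)) else 0

/-- A `(d,k)`-super-good path of boxes of side `ℓ` inside the block `v + [L]^d`,
joining `v + [ℓ]^d` to `v + (L-ℓ)e_α + [ℓ]^d`, of length at most `3L`:
all boxes good and at least one frameable. -/
def SuperGoodPath (k ℓ L : ℕ) (v : Site d) (α : Fin d) (η : Config d) : Prop :=
  ∃ n : ℕ, n ≤ 3 * L ∧ ∃ b : ℕ → Site d,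
    b 0 = v ∧
    (b n = fun j => v j + if j = α then (L : ℤ) - (ℓ : ℤ) else 0) ∧
    (∀ m < n, pathStep ℓ (b m) (b (m + 1))) ∧
    (∀ m ≤ n, genBox (corner (b m)) Finset.univ ℓ ⊆ genBox (corner v) Finset.univ L) ∧
    (∀ m ≤ n, GoodBox k (corner (b m)) Finset.univ ℓ η) ∧
    (∃ m ≤ n, Frameable k (corner (b m)) Finset.univ ℓ η)

/-- minimal corner of the external face of the box `genBox a univ m` in
direction `j`, on the positive (`s = true`) or negative side. -/
def faceBase (a : Site d) (m : ℕ) (j : Fin d) (s : Bool) : Site d :=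
  Function.update a j (if s then a j + m else a j - 1)

/-- The face `F` is adjacent to the vertex `v`. -/
def FaceNear (v : Site d) (F : Set (Site d)) : Prop := ∃ x ∈ F, ∀ i, |x i - v i| ≤ 1

/-- All `(d-1)`-dimensional external faces of the box `genBox a univ m` that are
adjacent to the vertex `v` are `(d-1, k-1)`-good. -/
def GoodFacesAt (k : ℕ) (a : Site d) (m : ℕ) (v : Site d) (η : Config d) : Prop :=
  ∀ (j : Fin d) (s : Bool),
    FaceNear v (genBox (faceBase a m j s) (Finset.univ.erase j) m) →
    GoodBox (k - 1) (faceBase a m j s) (Finset.univ.erase j) m η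

/-- The coarse vertices `v` and `v + (L+1)e_α` are `(d,k)`-block-connected. -/
def BlockConnected (k ℓ L : ℕ) (v : Site d) (α : Fin d) (η : Config d) : Prop :=
  SuperGoodPath k ℓ L v α η ∧
  GoodFacesAt k (corner v) ℓ v η ∧
  GoodFacesAt k (corner (fun j => v j + if j = α then (L : ℤ) - (ℓ : ℤ) else 0)) (ℓ + 1)
    (fun j => v j + if j = α then (L : ℤ) + 1 else 0) η

/-! ### `T`-step moves -/

/-- A `T`-step move with domain determined by the set of configurations `M`,
whose transitions are legal KA-`k`f transitions contained in `V`,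
keeping track of the position of a marked particle. -/
structure TStepMove (d k : ℕ) (M : Set (Config d)) (V : Set (Site d)) (T : ℕ) where
  conf : Config d → ℕ → Config d
  pos : Config d → Site d → ℕ → Site d
  conf_zero : ∀ η ∈ M, conf η 0 = η
  pos_zero : ∀ η ∈ M, ∀ z : Site d, η z = true → pos η z 0 = z
  step : ∀ η ∈ M, ∀ z : Site d, η z = true → ∀ t < T,
    (conf η (t + 1) = conf η t ∧ pos η z (t + 1) = pos η z t) ∨
    ∃ x y, adj x y ∧ x ∈ V ∧ y ∈ V ∧ conf η t x = true ∧ conf η t y = false ∧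
      constraint k (conf η t) x y ∧ conf η (t + 1) = swap (conf η t) x y ∧
      pos η z (t + 1) = if pos η z t = x then y else pos η z t

/-- `Loss(M) ≤ K` : at every step, at most `2^K` configurations of the domain
have a common image. -/
def LossBoundedBy {d k : ℕ} {M : Set (Config d)} {V : Set (Site d)} {T : ℕ}
    (mv : TStepMove d k M V T) (K : ℝ) : Prop :=
  ∀ t < T, ∀ η' ∈ M, ∃ S : Finset (Config d),
    {η ∈ M | mv.conf η t = mv.conf η' t ∧ mv.conf η (t + 1) = mv.conf η' (t + 1)} ⊆ ↑S ∧
    (S.card : ℝ) ≤ (2 : ℝ) ^ K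

/-! ### Bond configurations on the coarse lattice -/

/-- A bond configuration on the coarse lattice: the edge `(i, α)` joins the
coarse vertices of index `i` and `i + e_α`. -/
abbrev BondConfig (d : ℕ) := (Site d × Fin d) → Bool

def IsLocalBond (g : BondConfig d → ℝ) : Prop :=
  ∃ S : Finset (Site d × Fin d), ∀ ω ω' : BondConfig d, (∀ e ∈ S, ω e = ω' e) → g ω = g ω'

/-- Translation of a bond configuration by a coarse index vector. -/
def bondShift (v : Site d) (ω : BondConfig d) : BondConfig d := fun e => (ω (e.1 - v, e.2))

/-- Two coarse indices joined by an open bond. -/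
def bondRel (ω : BondConfig d) (i j : Site d) : Prop :=
  (∃ α, j = i + eVec d α ∧ ω (i, α) = true) ∨ (∃ α, i = j + eVec d α ∧ ω (j, α) = true)

/-- The event `{0 ↔ ∞}`: the origin lies in an infinite open cluster. -/
def InfiniteCluster : Set (BondConfig d) :=
  {ω | {j : Site d | Relation.ReflTransGen (bondRel ω) origin j}.Infinite}

/-- The coarse index of the neighbour `± e_α` of the coarse origin. -/
def coarseIdx (d : ℕ) (α : Fin d) (s : Bool) : Site d :=
  if s then eVec d α else -(eVec d α)

/-- The actual lattice vector `±(L+1) e_α` of a coarse neighbour of the origin. -/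
def coarseVecZ (d L : ℕ) (α : Fin d) (s : Bool) : Site d :=
  fun j => ((L : ℤ) + 1) * coarseIdx d α s j

/-- Indicator of the bond between the coarse origin and its neighbour `± e_α`. -/
def edgeInd (ω : BondConfig d) (α : Fin d) (s : Bool) : ℝ≥0∞ :=
  if (if s then ω (origin, α) else ω (-(eVec d α), α)) = true then 1 else 0

/-- The auxiliary quadratic form `u ↦ u ⬝ D_aux u`. -/
def QauxForm (d L : ℕ) (μstar : Measure (BondConfig d)) (u : Fin d → ℝ) : ℝ≥0∞ :=
  ⨅ g : {g : BondConfig d → ℝ // IsLocalBond g},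
    ∑ α : Fin d, ∑ s : Bool,
      ∫⁻ ω, edgeInd ω α s *
        ENNReal.ofReal (((if s then (1 : ℝ) else -1) * ((L : ℝ) + 1) * u α +
          g.1 (bondShift (coarseIdx d α s) ω) - g.1 ω) ^ 2) ∂μstar

/-- Indicator (on microscopic configurations) that the coarse origin and its
neighbour `± e_α` are block-connected, for an abstract notion `BC`. -/
def microEdgeInd (BC : Site d → Fin d → Config d → Bool) (α : Fin d) (s : Bool)
    (η : Config d) : ℝ≥0∞ :=
  if (if s then BC origin α η else BC (-(eVec d α)) α η) = true then 1 else 0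

/-- The microscopic comparison form
`u ↦ inf_f Σ_{i ∼ 0} μ₀[ η̄_{0i} (u·i + f(τ_i η^{0,i}) - f(η))² ]`. -/
def microForm (d k L : ℕ) (BC : Site d → Fin d → Config d → Bool)
    (μ0 : Measure (Config d)) (u : Fin d → ℝ) : ℝ≥0∞ :=
  ⨅ f : {f : Config d → ℝ // IsLocal f},
    ∑ α : Fin d, ∑ s : Bool,
      ∫⁻ η, microEdgeInd BC α s η *
        ENNReal.ofReal (((if s then (1 : ℝ) else -1) * ((L : ℝ) + 1) * u α +
          f.1 (shift (coarseVecZ d L α s) (swap η origin (coarseVecZ d L α s))) - f.1 η) ^ 2)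
        ∂μ0

/-! ### d = 2 geometry -/

/-- The column `y + {c} × [ℓ]` in `ℤ²`. -/
def col2 (y : Site 2) (c : ℤ) (ℓ : ℕ) : Set (Site 2) :=
  {x | x 0 = y 0 + c ∧ y 1 + 1 ≤ x 1 ∧ x 1 ≤ y 1 + ℓ}

/-- The box `b + [ℓ]²`. -/
def box2 (b : Site 2) (ℓ : ℕ) : Set (Site 2) := genBox (corner b) Finset.univ ℓ

/-- `S` contains at least two empty sites. -/
def TwoEmptyIn (S : Set (Site 2)) (η : Config 2) : Prop :=
  ∃ a ∈ S, ∃ b ∈ S, a ≠ b ∧ η a = false ∧ η b = false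

/-- Every row and every column of the box `b + [ℓ]²` contains at least two
empty sites. -/
def RowsColsOK (b : Site 2) (ℓ : ℕ) (η : Config 2) : Prop :=
  (∀ t : ℕ, 1 ≤ t → t ≤ ℓ → TwoEmptyIn {z | z ∈ box2 b ℓ ∧ z 1 = b 1 + t} η) ∧
  (∀ t : ℕ, 1 ≤ t → t ≤ ℓ → TwoEmptyIn {z | z ∈ box2 b ℓ ∧ z 0 = b 0 + t} η)

/-- The box `b + [ℓ]²` is `(2,2)`-good: two empty sites in every row and
column, plus one additional empty site. -/
def Good22 (b : Site 2) (ℓ : ℕ) (η : Config 2) : Prop :=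
  RowsColsOK b ℓ η ∧
  ∃ w ∈ box2 b ℓ, η w = false ∧ RowsColsOK b ℓ (Function.update η w true)

/-! ### Bootstrap percolation -/

/-- The box `[-ℓ, ℓ]^d`. -/
def bigBox (d ℓ : ℕ) : Set (Site d) := {x | ∀ i, |x i| ≤ (ℓ : ℤ)}

/-- One step of `k`-neighbour bootstrap percolation on `[-ℓ,ℓ]^d` (sites
outside the box are left unchanged). -/
def BPstep (k ℓ : ℕ) (η : Config d) : Config d := fun x =>
  if x ∈ bigBox d ℓ then
    (if η x = true ∧
        ((neighbors x).filter fun z => z ∈ bigBox d ℓ ∧ η z = false).card < k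
      then true else false)
  else η x

/-- The limiting configuration of bootstrap percolation. -/
def BPinf (k ℓ : ℕ) (η : Config d) : Config d := fun x =>
  if ∀ t : ℕ, (BPstep k ℓ)^[t] η x = true then true else false

/-- One step along the bootstrap percolation cluster. -/
def bpRel (k ℓ : ℕ) (η : Config d) (a b : Site d) : Prop :=
  adj a b ∧ b ∈ bigBox d ℓ ∧ BPinf k ℓ η b = false

/-- The bootstrap percolation cluster of the origin. -/
def bpCluster (k ℓ : ℕ) (η : Config d) : Set (Site d) :=
  {x | Relation.ReflTransGen (bpRel k ℓ η) origin x}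

def coord0 (x : Site d) : ℤ := if h : 0 < d then x ⟨0, h⟩ else 0

/-- The first coordinate of the rightmost site of the bootstrap percolation
cluster of the origin. -/
def bpRightmost (k ℓ : ℕ) (η : Config d) : ℝ :=
  sSup ((fun x : Site d => (coord0 x : ℝ)) '' bpCluster k ℓ η)

/-- The test function `f`, computed on the restriction to `[-ℓ,ℓ]^d`. -/
def fTest (d k ℓ : ℕ) (η : Config d) : ℝ :=
  bpRightmost k ℓ (fillOutside (bigBox d ℓ) η)

/-- The event `B` : the bootstrap percolation cluster of the origin contains a
site of `ℓ^∞`-norm at least `ℓ - 1`. -/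
def Bevent (k ℓ : ℕ) (η : Config d) : Prop :=
  ∃ x ∈ bpCluster k ℓ η, ∃ i, (ℓ : ℤ) - 1 ≤ |x i|

set_option linter.unusedSimpArgs false

/-! ### Labelled configurations and families of them -/

/-- Labelled configurations: `none` = empty, `some l` = the particle with label `l`. -/
abbrev Lab := Site 2 → Option (Site 2)

/-- A legal KA transition of a labelled configuration inside `[ℓ]²`. -/
def PStep (ℓ : ℕ) (L L' : Lab) : Prop :=
  ∃ x y, adj x y ∧ x ∈ box2 origin ℓ ∧ y ∈ box2 origin ℓ ∧ L x ≠ none ∧ L y = none ∧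
    (∃ z, adj x z ∧ z ≠ y ∧ L z = none) ∧ (∃ z, adj y z ∧ z ≠ x ∧ L z = none) ∧
    L' = L ∘ Equiv.swap x y

/-- Simultaneous (lazy) steps of a family of labelled configurations. -/
def FStep {ι : Type} (ℓ : ℕ) (F F' : ι → Lab) : Prop :=
  ∀ i, F' i = F i ∨ PStep ℓ (F i) (F' i)

/-- Reachability for families. -/
abbrev Eqv {ι : Type} (ℓ : ℕ) (F F' : ι → Lab) : Prop :=
  Relation.ReflTransGen (FStep ℓ) F F'

/-- Permute the sites of all members of a family. -/
def act {ι : Type} (F : ι → Lab) (g : Equiv.Perm (Site 2)) : ι → Lab := fun i => F i ∘ g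

lemma act_apply {ι : Type} (F : ι → Lab) (g : Equiv.Perm (Site 2)) (i : ι) (z : Site 2) :
    act F g i z = F i (g z) := rfl

lemma act_act {ι : Type} (F : ι → Lab) (g h : Equiv.Perm (Site 2)) :
    act (act F g) h = act F (g * h) := rfl

lemma act_one {ι : Type} (F : ι → Lab) : act F 1 = F := rfl

lemma adj_symm {x y : Site 2} (h : adj x y) : adj y x := by
  unfold adj at *
  rw [← h]
  exact Finset.sum_congr rfl fun i _ => abs_sub_comm _ _

lemma adj_ne {x y : Site 2} (h : adj x y) : x ≠ y := by
  rintro rfl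
  simp [adj] at h

lemma pstep_symm {ℓ : ℕ} {L L' : Lab} (h : PStep ℓ L L') : PStep ℓ L' L := by
  obtain ⟨x, y, hxy, hx, hy, hLx, hLy, ⟨z, hz, hzy, hLz⟩, ⟨w, hw, hwx, hLw⟩, rfl⟩ := h
  refine ⟨y, x, adj_symm hxy, hy, hx, ?_, ?_, ⟨w, hw, hwx, ?_⟩, ⟨z, hz, hzy, ?_⟩, ?_⟩
  · simpa using hLx
  · simpa using hLy
  · rw [Function.comp_apply, Equiv.swap_apply_of_ne_of_ne hwx (adj_ne hw).symm, hLw]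
  · rw [Function.comp_apply, Equiv.swap_apply_of_ne_of_ne (adj_ne hz).symm hzy, hLz]
  · funext u
    simp [Equiv.swap_comm y x]

lemma eqv_symm {ι : Type} {ℓ : ℕ} {F F' : ι → Lab} (h : Eqv ℓ F F') : Eqv ℓ F' F := by
  have : Std.Symm (FStep (ι := ι) ℓ) := by
    constructor
    intro a b hab i
    rcases hab i with h | h
    · exact Or.inl h.symm
    · exact Or.inr (pstep_symm h)
  induction h with
  | refl => exact Relation.ReflTransGen.refl
  | tail _ h ih => exact Relation.ReflTransGen.head (this.symm _ _ h) ih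

/-- The basic move: exchanging two adjacent sites, one of which is empty. -/
lemma eqv_free {ι : Type} {ℓ : ℕ} (F : ι → Lab) (x y : Site 2) (hxy : adj x y)
    (hx : x ∈ box2 origin ℓ) (hy : y ∈ box2 origin ℓ)
    (h : ∀ i, (F i x = none ∨ F i y = none) ∧ (∃ z, adj x z ∧ z ≠ y ∧ F i z = none) ∧
      (∃ z, adj y z ∧ z ≠ x ∧ F i z = none)) :
    Eqv ℓ F (act F (Equiv.swap x y)) := by
  apply Relation.ReflTransGen.single
  intro i
  obtain ⟨h1, h2, h3⟩ := h i
  by_cases hx0 : F i x = none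
  · by_cases hy0 : F i y = none
    · left
      funext z
      rw [act_apply, Equiv.swap_apply_def]
      split_ifs with ha hb
      · rw [hy0, ha, hx0]
      · rw [hx0, hb, hy0]
      · rfl
    · right
      refine ⟨y, x, adj_symm hxy, hy, hx, hy0, hx0, h3, h2, ?_⟩
      rw [Equiv.swap_comm]
      rfl
  · right
    exact ⟨x, y, hxy, hx, hy, hx0, h1.resolve_left hx0, h2, h3, rfl⟩

/-! ### Coordinates, in either of the two orientations -/

/-- The site with coordinates `(c, r)`, or its reflection. -/
def pt (b : Bool) (c r : ℤ) : Site 2 := if b then ![c, r] else ![r, c]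

lemma pt_inj (b : Bool) (c r c' r' : ℤ) : pt b c r = pt b c' r' ↔ c = c' ∧ r = r' := by
  cases b <;> simp [pt, and_comm]

lemma pt_box (b : Bool) (ℓ : ℕ) (c r : ℤ) :
    pt b c r ∈ box2 origin ℓ ↔ (1 ≤ c ∧ c ≤ ℓ) ∧ (1 ≤ r ∧ r ≤ ℓ) := by
  cases b <;> simp [pt, box2, genBox, corner, origin, Fin.forall_fin_two] <;> omega

lemma pt_adj_c (b : Bool) (c r : ℤ) : adj (pt b c r) (pt b (c + 1) r) := by
  cases b <;> simp [pt, adj, Fin.sum_univ_two]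

lemma pt_adj_r (b : Bool) (c r : ℤ) : adj (pt b c r) (pt b c (r + 1)) := by
  cases b <;> simp [pt, adj, Fin.sum_univ_two]

lemma pt_adj_c' (b : Bool) (c r : ℤ) : adj (pt b (c + 1) r) (pt b c r) := adj_symm (pt_adj_c b c r)

lemma pt_adj_r' (b : Bool) (c r : ℤ) : adj (pt b c (r + 1)) (pt b c r) := adj_symm (pt_adj_r b c r)

/-- Rewriting values of a family after an exchange of two sites. -/
lemma act_swap {ι : Type} (F : ι → Lab) (i : ι) (b : Bool) (c r c' r' c'' r'' : ℤ) :
    act F (Equiv.swap (pt b c r) (pt b c' r')) i (pt b c'' r'') =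
      if c'' = c ∧ r'' = r then F i (pt b c' r') else
        if c'' = c' ∧ r'' = r' then F i (pt b c r) else F i (pt b c'' r'') := by
  rw [act_apply, Equiv.swap_apply_def]
  simp only [pt_inj]
  split_ifs <;> rfl

lemma two_ne (c : ℤ) : ¬ c + 1 + 1 = c := by omega

lemma two_ne' (c : ℤ) : ¬ c = c + 1 + 1 := by omega

/-- One particle in a `2 × 2` block moves to the opposite corner. -/
lemma gadget22 {ι : Type} {ℓ : ℕ} (b : Bool) (F : ι → Lab) (c r : ℤ) (hc : 1 ≤ c) (hr : 1 ≤ r)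
    (hc' : c + 1 ≤ ℓ) (hr' : r + 1 ≤ ℓ)
    (h : ∀ i, F i (pt b c r) = none ∧ F i (pt b (c + 1) r) = none ∧
      F i (pt b c (r + 1)) = none) :
    Eqv ℓ F (act F (Equiv.swap (pt b c r) (pt b (c + 1) (r + 1)))) := by
  have e1 := eqv_free (ℓ := ℓ) F (pt b (c + 1) r) (pt b (c + 1) (r + 1)) (pt_adj_r _ _ _)
    ((pt_box ..).2 (by omega)) ((pt_box ..).2 (by omega)) (fun i => by
      obtain ⟨h1, h2, h3⟩ := h i
      exact ⟨Or.inl h2, ⟨pt b c r, pt_adj_c' _ _ _, by simp [pt_inj], h1⟩,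
        ⟨pt b c (r + 1), pt_adj_c' _ _ _, by simp [pt_inj], h3⟩⟩)
  refine e1.trans ?_
  have e2 := eqv_free (ℓ := ℓ) (act F (Equiv.swap (pt b (c + 1) r) (pt b (c + 1) (r + 1))))
    (pt b c r) (pt b (c + 1) r) (pt_adj_c _ _ _)
    ((pt_box ..).2 (by omega)) ((pt_box ..).2 (by omega)) (fun i => by
      obtain ⟨h1, h2, h3⟩ := h i
      exact ⟨Or.inl (by simp [act_swap, h1]),
        ⟨pt b c (r + 1), pt_adj_r _ _ _, by simp [pt_inj], by simp [act_swap, h3]⟩,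
        ⟨pt b (c + 1) (r + 1), pt_adj_r _ _ _, by simp [pt_inj], by simp [act_swap, h2]⟩⟩)
  refine e2.trans (Eq.subst (motive := fun G => Eqv ℓ _ G) ?_ Relation.ReflTransGen.refl)
  funext i z
  obtain ⟨h1, h2, h3⟩ := h i
  simp only [act_apply, Equiv.swap_apply_def]
  by_cases k1 : z = pt b c r
  · subst k1; simp [pt_inj]
  by_cases k2 : z = pt b (c + 1) r
  · subst k2; simp [pt_inj, h1, h2]
  by_cases k3 : z = pt b (c + 1) (r + 1)
  · subst k3; simp [pt_inj, h1, h2]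
  simp [k1, k2, k3]

/-- Two particles in a `2 × 3` block with an empty row are exchanged. -/
lemma gadget23 {ι : Type} {ℓ : ℕ} (b : Bool) (F : ι → Lab) (c r : ℤ) (hc : 1 ≤ c) (hr : 1 ≤ r)
    (hc' : c + 1 + 1 ≤ ℓ) (hr' : r + 1 ≤ ℓ)
    (h : ∀ i, F i (pt b c r) = none ∧ F i (pt b (c + 1) r) = none ∧
      F i (pt b (c + 1 + 1) r) = none ∧ F i (pt b c (r + 1)) = none) :
    Eqv ℓ F (act F (Equiv.swap (pt b (c + 1) (r + 1)) (pt b (c + 1 + 1) (r + 1)))) := by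
  obtain ⟨G1, hG1⟩ : ∃ G, G = act F (Equiv.swap (pt b (c + 1) r) (pt b (c + 1) (r + 1))) :=
    ⟨_, rfl⟩
  obtain ⟨G2, hG2⟩ : ∃ G, G = act G1
    (Equiv.swap (pt b (c + 1) (r + 1)) (pt b (c + 1 + 1) (r + 1))) := ⟨_, rfl⟩
  obtain ⟨G3, hG3⟩ : ∃ G, G = act G2
    (Equiv.swap (pt b (c + 1) r) (pt b (c + 1 + 1) r)) := ⟨_, rfl⟩
  obtain ⟨G4, hG4⟩ : ∃ G, G = act G3
    (Equiv.swap (pt b c (r + 1)) (pt b (c + 1) (r + 1))) := ⟨_, rfl⟩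
  obtain ⟨G5, hG5⟩ : ∃ G, G = act G4
    (Equiv.swap (pt b (c + 1 + 1) r) (pt b (c + 1 + 1) (r + 1))) := ⟨_, rfl⟩
  have v1 : ∀ i, G1 i (pt b c r) = none ∧ G1 i (pt b (c + 1 + 1) r) = none ∧
      G1 i (pt b c (r + 1)) = none ∧ G1 i (pt b (c + 1) (r + 1)) = none := by
    intro i
    obtain ⟨h1, h2, h3, h4⟩ := h i
    subst hG1
    simp [act_swap, h1, h2, h3, h4, two_ne, two_ne']
  have v2 : ∀ i, G2 i (pt b c r) = none ∧ G2 i (pt b (c + 1 + 1) r) = none ∧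
      G2 i (pt b c (r + 1)) = none ∧ G2 i (pt b (c + 1 + 1) (r + 1)) = none := by
    intro i
    obtain ⟨h1, h2, h3, h4⟩ := v1 i
    subst hG2
    simp [act_swap, h1, h2, h3, h4, two_ne, two_ne']
  have v3 : ∀ i, G3 i (pt b c r) = none ∧ G3 i (pt b (c + 1) r) = none ∧
      G3 i (pt b c (r + 1)) = none ∧ G3 i (pt b (c + 1 + 1) (r + 1)) = none := by
    intro i
    obtain ⟨h1, h2, h3, h4⟩ := v2 i
    subst hG3
    simp [act_swap, h1, h2, h3, h4, two_ne, two_ne']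
  have v4 : ∀ i, G4 i (pt b c r) = none ∧ G4 i (pt b (c + 1) r) = none ∧
      G4 i (pt b (c + 1) (r + 1)) = none ∧ G4 i (pt b (c + 1 + 1) (r + 1)) = none := by
    intro i
    obtain ⟨h1, h2, h3, h4⟩ := v3 i
    subst hG4
    simp [act_swap, h1, h2, h3, h4, two_ne, two_ne']
  have v5 : ∀ i, G5 i (pt b c r) = none ∧ G5 i (pt b (c + 1) r) = none ∧
      G5 i (pt b (c + 1) (r + 1)) = none ∧ G5 i (pt b (c + 1 + 1) r) = none := by
    intro i
    obtain ⟨h1, h2, h3, h4⟩ := v4 i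
    subst hG5
    simp [act_swap, h1, h2, h3, h4, two_ne, two_ne']
  have s1 : Eqv ℓ F G1 := by
    rw [hG1]
    refine eqv_free _ _ _ (pt_adj_r _ _ _) ((pt_box ..).2 (by omega)) ((pt_box ..).2 (by omega))
      fun i => ⟨Or.inl (h i).2.1, ⟨pt b c r, pt_adj_c' _ _ _, by simp [pt_inj], (h i).1⟩,
        ⟨pt b c (r + 1), pt_adj_c' _ _ _, by simp [pt_inj], (h i).2.2.2⟩⟩
  have s2 : Eqv ℓ G1 G2 := by
    rw [hG2]
    refine eqv_free _ _ _ (pt_adj_c _ _ _) ((pt_box ..).2 (by omega)) ((pt_box ..).2 (by omega))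
      fun i => ⟨Or.inl (v1 i).2.2.2,
        ⟨pt b c (r + 1), pt_adj_c' _ _ _, by simp [pt_inj, two_ne, two_ne'], (v1 i).2.2.1⟩,
        ⟨pt b (c + 1 + 1) r, pt_adj_r' _ _ _, by simp [pt_inj], (v1 i).2.1⟩⟩
  have s3 : Eqv ℓ G2 G3 := by
    rw [hG3]
    refine eqv_free _ _ _ (pt_adj_c _ _ _) ((pt_box ..).2 (by omega)) ((pt_box ..).2 (by omega))
      fun i => ⟨Or.inr (v2 i).2.1,
        ⟨pt b c r, pt_adj_c' _ _ _, by simp [pt_inj, two_ne, two_ne'], (v2 i).1⟩,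
        ⟨pt b (c + 1 + 1) (r + 1), pt_adj_r _ _ _, by simp [pt_inj], (v2 i).2.2.2⟩⟩
  have s4 : Eqv ℓ G3 G4 := by
    rw [hG4]
    refine eqv_free _ _ _ (pt_adj_c _ _ _) ((pt_box ..).2 (by omega)) ((pt_box ..).2 (by omega))
      fun i => ⟨Or.inl (v3 i).2.2.1,
        ⟨pt b c r, pt_adj_r' _ _ _, by simp [pt_inj], (v3 i).1⟩,
        ⟨pt b (c + 1) r, pt_adj_r' _ _ _, by simp [pt_inj], (v3 i).2.1⟩⟩
  have s5 : Eqv ℓ G4 G5 := by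
    rw [hG5]
    refine eqv_free _ _ _ (pt_adj_r _ _ _) ((pt_box ..).2 (by omega)) ((pt_box ..).2 (by omega))
      fun i => ⟨Or.inr (v4 i).2.2.2,
        ⟨pt b (c + 1) r, pt_adj_c' _ _ _, by simp [pt_inj], (v4 i).2.1⟩,
        ⟨pt b (c + 1) (r + 1), pt_adj_c' _ _ _, by simp [pt_inj], (v4 i).2.2.1⟩⟩
  have s6 : Eqv ℓ G5 (act G5 (Equiv.swap (pt b c (r + 1)) (pt b (c + 1) (r + 1)))) := by
    refine eqv_free _ _ _ (pt_adj_c _ _ _) ((pt_box ..).2 (by omega)) ((pt_box ..).2 (by omega))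
      fun i => ⟨Or.inr (v5 i).2.2.1,
        ⟨pt b c r, pt_adj_r' _ _ _, by simp [pt_inj], (v5 i).1⟩,
        ⟨pt b (c + 1) r, pt_adj_r' _ _ _, by simp [pt_inj], (v5 i).2.1⟩⟩
  have key : act G5 (Equiv.swap (pt b c (r + 1)) (pt b (c + 1) (r + 1))) =
      act F (Equiv.swap (pt b (c + 1) (r + 1)) (pt b (c + 1 + 1) (r + 1))) := by
    subst hG5 hG4 hG3 hG2 hG1
    funext i z
    obtain ⟨h1, h2, h3, h4⟩ := h i
    by_cases k1 : z = pt b c r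
    · subst k1; simp [act_swap, h1, h2, h3, h4, two_ne, two_ne']
    by_cases k2 : z = pt b (c + 1) r
    · subst k2; simp [act_swap, h1, h2, h3, h4, two_ne, two_ne']
    by_cases k3 : z = pt b (c + 1 + 1) r
    · subst k3; simp [act_swap, h1, h2, h3, h4, two_ne, two_ne']
    by_cases k4 : z = pt b c (r + 1)
    · subst k4; simp [act_swap, h1, h2, h3, h4, two_ne, two_ne']
    by_cases k5 : z = pt b (c + 1) (r + 1)
    · subst k5; simp [act_swap, two_ne, two_ne']
    by_cases k6 : z = pt b (c + 1 + 1) (r + 1)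
    · subst k6; simp [act_swap, two_ne, two_ne']
    simp [act_apply, Equiv.swap_apply_def, k1, k2, k3, k4, k5, k6]
  rw [← key]
  exact s1.trans (s2.trans (s3.trans (s4.trans (s5.trans s6))))

lemma mul_swap_comm {π : Equiv.Perm (Site 2)} {x y : Site 2} (hx : π x = x) (hy : π y = y) :
    π * Equiv.swap x y = Equiv.swap x y * π := by
  rw [Equiv.mul_swap_eq_swap_mul, hx, hy]

/-- With an empty row below, and an empty site to the left, neighbours in a row are exchanged. -/
lemma row_swap {ι : Type} {ℓ : ℕ} (b : Bool) (r : ℤ) (hr : 1 ≤ r) (hr' : r + 1 ≤ ℓ) (n : ℕ) :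
    ∀ (F : ι → Lab) (c : ℤ), 1 ≤ c → c + n + 1 + 1 ≤ ℓ →
    (∀ i, ∀ a, c ≤ a → a ≤ ℓ → F i (pt b a r) = none) →
    (∀ i, F i (pt b c (r + 1)) = none) →
    Eqv ℓ F (act F (Equiv.swap (pt b (c + n + 1) (r + 1)) (pt b (c + n + 1 + 1) (r + 1)))) := by
  induction n with
  | zero =>
    intro F c hc hc' h1 h2
    simp only [Nat.cast_zero, add_zero] at *
    exact gadget23 b F c r hc hr hc' hr' fun i =>
      ⟨h1 i _ (by omega) (by omega), h1 i _ (by omega) (by omega), h1 i _ (by omega) (by omega),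
        h2 i⟩
  | succ n ih =>
    intro F c hc hc' h1 h2
    push_cast at *
    have vac : ∀ G : ι → Lab, (∀ i, ∀ a, c ≤ a → a ≤ ℓ → G i (pt b a r) = none) →
        (∀ i, G i (pt b c (r + 1)) = none) →
        Eqv ℓ G (act G (Equiv.swap (pt b c (r + 1)) (pt b (c + 1) (r + 1)))) := by
      intro G g1 g2
      exact eqv_free _ _ _ (pt_adj_c _ _ _) ((pt_box ..).2 (by omega)) ((pt_box ..).2 (by omega))
        fun i => ⟨Or.inl (g2 i),
          ⟨pt b c r, pt_adj_r' _ _ _, by simp [pt_inj], g1 i _ (by omega) (by omega)⟩,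
          ⟨pt b (c + 1) r, pt_adj_r' _ _ _, by simp [pt_inj], g1 i _ (by omega) (by omega)⟩⟩
    have e1 := vac F h1 h2
    have e2 := ih (act F (Equiv.swap (pt b c (r + 1)) (pt b (c + 1) (r + 1)))) (c + 1)
      (by omega) (by omega)
      (fun i a ha ha' => by
        rw [act_swap, if_neg (by omega), if_neg (by omega)]
        exact h1 i a (by omega) ha')
      (fun i => by
        rw [act_swap, if_neg (by omega), if_pos (by omega)]
        exact h2 i)
    rw [show c + 1 + (n : ℤ) + 1 = c + (n + 1) + 1 by ring] at e2
    have e3 := vac (act F (Equiv.swap (pt b (c + (n + 1) + 1) (r + 1))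
        (pt b (c + (n + 1) + 1 + 1) (r + 1))))
      (fun i a ha ha' => by
        rw [act_swap, if_neg (by omega), if_neg (by omega)]
        exact h1 i a (by omega) ha')
      (fun i => by
        rw [act_swap, if_neg (by omega), if_neg (by omega)]
        exact h2 i)
    rw [act_act, mul_swap_comm] at e2
    · exact (e1.trans e2).trans (eqv_symm e3)
    · apply Equiv.swap_apply_of_ne_of_ne <;> rw [Ne, pt_inj] <;> omega
    · apply Equiv.swap_apply_of_ne_of_ne <;> rw [Ne, pt_inj] <;> omega

/-- The row `r + 1` can be emptied into the (empty) row `r`. -/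
lemma lower_row (ι : Type) {ℓ : ℕ} (b : Bool) (r : ℤ) (hr : 1 ≤ r) (hr' : r + 1 ≤ ℓ) (n : ℕ) :
    (n : ℤ) + 1 ≤ ℓ → ∃ π : Equiv.Perm (Site 2),
    (∀ a s, s ≠ r → s ≠ r + 1 → π (pt b a s) = pt b a s) ∧
    ∀ F : ι → Lab, (∀ i, ∀ a : ℤ, 1 ≤ a → a ≤ ℓ → F i (pt b a r) = none) →
      (∀ i, F i (pt b 1 (r + 1)) = none) →
      Eqv ℓ F (act F π) ∧
      ∀ i, (∀ a, (n : ℤ) + 1 ≤ a → a ≤ ℓ → act F π i (pt b a r) = none) ∧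
        (∀ a, 1 ≤ a → a ≤ (n : ℤ) + 1 → act F π i (pt b a (r + 1)) = none) := by
  induction n with
  | zero =>
    intro _
    refine ⟨1, fun _ _ _ _ => rfl, fun F h1 h2 => ⟨Relation.ReflTransGen.refl, fun i => ⟨?_, ?_⟩⟩⟩
    · intro a ha ha'
      exact h1 i a (by simpa using ha) ha'
    · intro a ha ha'
      obtain rfl : a = 1 := by simp at ha'; omega
      exact h2 i
  | succ n ih =>
    intro hn
    push_cast at *
    obtain ⟨π, hπ, hF⟩ := ih (by omega)
    refine ⟨π * Equiv.swap (pt b (n + 1) r) (pt b (n + 1 + 1) (r + 1)), ?_, ?_⟩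
    · intro a s hs hs'
      rw [Equiv.Perm.mul_apply, Equiv.swap_apply_of_ne_of_ne, hπ a s hs hs'] <;>
        rw [Ne, pt_inj] <;> omega
    · intro F h1 h2
      obtain ⟨e, hv⟩ := hF F h1 h2
      refine ⟨e.trans ?_, ?_⟩
      · rw [← act_act]
        exact gadget22 b _ _ _ (by omega) hr (by omega) hr' fun i =>
          ⟨(hv i).1 _ (by omega) (by omega), (hv i).1 _ (by omega) (by omega),
            (hv i).2 _ (by omega) (by omega)⟩
      · intro i
        rw [← act_act]
        refine ⟨fun a ha ha' => ?_, fun a ha ha' => ?_⟩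
        · rw [act_swap, if_neg (by omega), if_neg (by omega)]
          exact (hv i).1 a (by omega) ha'
        · rw [act_swap, if_neg (by omega)]
          split_ifs with hh
          · exact (hv i).1 _ (by omega) (by omega)
          · exact (hv i).2 a ha (by omega)

/-- Neighbours in a row of a framed box are exchanged. -/
lemma frame_swap {ι : Type} {ℓ : ℕ} (b : Bool) (c : ℤ) (hc : 2 ≤ c) (hc' : c + 1 ≤ ℓ) (n : ℕ) :
    ∀ (F : ι → Lab) (r : ℤ), 1 ≤ r → r + n + 1 ≤ ℓ →
    (∀ i, ∀ a : ℤ, 1 ≤ a → a ≤ ℓ → F i (pt b a r) = none) →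
    (∀ i, ∀ s, r ≤ s → s ≤ ℓ → F i (pt b 1 s) = none) →
    Eqv ℓ F (act F (Equiv.swap (pt b c (r + n + 1)) (pt b (c + 1) (r + n + 1)))) := by
  induction n with
  | zero =>
    intro F r hr hr' h1 h2
    obtain ⟨m, hm⟩ : ∃ m : ℕ, c = 1 + m + 1 := ⟨(c - 2).toNat, by omega⟩
    subst hm
    simp only [Nat.cast_zero, add_zero] at *
    exact row_swap b r hr hr' m F 1 le_rfl hc' h1 fun i => h2 i _ (by omega) hr'
  | succ n ih =>
    intro F r hr hr' h1 h2
    push_cast at *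
    obtain ⟨π, hπ, hF⟩ := lower_row ι (ℓ := ℓ) b r hr (by omega) (ℓ - 1) (by omega)
    obtain ⟨e1, hv⟩ := hF F h1 fun i => h2 i _ (by omega) (by omega)
    have e2 := ih (act F π) (r + 1) (by omega) (by omega)
      (fun i a ha ha' => (hv i).2 a ha (by omega))
      (fun i s hs hs' => by
        by_cases h : s = r + 1
        · subst h
          exact (hv i).2 1 le_rfl (by omega)
        · rw [act_apply, hπ _ _ (by omega) h]
          exact h2 i s (by omega) hs')
    rw [show r + 1 + (n : ℤ) + 1 = r + (n + 1) + 1 by ring] at e2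
    have e3 := (hF (act F (Equiv.swap (pt b c (r + (n + 1) + 1))
        (pt b (c + 1) (r + (n + 1) + 1))))
      (fun i a ha ha' => by
        rw [act_swap, if_neg (by omega), if_neg (by omega)]
        exact h1 i a ha ha')
      (fun i => by
        rw [act_swap, if_neg (by omega), if_neg (by omega)]
        exact h2 i _ (by omega) (by omega))).1
    rw [act_act, mul_swap_comm (hπ _ _ (by omega) (by omega)) (hπ _ _ (by omega) (by omega))] at e2
    exact (e1.trans e2).trans (eqv_symm e3)

/-! ### Generating all permutations -/

/-- The sites `[2,ℓ]²`. -/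
def inner (ℓ : ℕ) : Set (Site 2) := {z : Site 2 | ∀ i, 2 ≤ z i ∧ z i ≤ (ℓ : ℤ)}

lemma pt_inner (b : Bool) (ℓ : ℕ) (c r : ℤ) :
    pt b c r ∈ inner ℓ ↔ (2 ≤ c ∧ c ≤ ℓ) ∧ (2 ≤ r ∧ r ≤ ℓ) := by
  cases b <;> simp [pt, inner, Fin.forall_fin_two] <;> omega

/-- All members of the family are framed. -/
def FramedF {ι : Type} (ℓ : ℕ) (F : ι → Lab) : Prop :=
  ∀ i, ∀ z ∈ box2 origin ℓ, (z 0 = 1 ∨ z 1 = 1) → F i z = none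

/-- The generating transpositions. -/
def gens (ℓ : ℕ) : Set (Equiv.Perm (Site 2)) :=
  {g | ∃ b c r, pt b c r ∈ inner ℓ ∧ pt b (c + 1) r ∈ inner ℓ ∧
    g = Equiv.swap (pt b c r) (pt b (c + 1) r)}

lemma framed_act {ι : Type} {ℓ : ℕ} {F : ι → Lab} (h : FramedF ℓ F) {g : Equiv.Perm (Site 2)}
    (hg : ∀ z ∉ inner ℓ, g z = z) : FramedF ℓ (act F g) := by
  intro i z hz hz1
  rw [act_apply, hg]
  · exact h i z hz hz1
  · intro hin
    have h0 := hin 0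
    have h1 := hin 1
    omega

lemma gens_closure {ℓ : ℕ} {g : Equiv.Perm (Site 2)} (hg : g ∈ Subgroup.closure (gens ℓ)) :
    (∀ z ∉ inner ℓ, g z = z) ∧
      ∀ (ι : Type) (F : ι → Lab), FramedF ℓ F → Eqv ℓ F (act F g) := by
  induction hg using Subgroup.closure_induction with
  | mem g hg =>
    obtain ⟨b, c, r, h1, h2, rfl⟩ := hg
    refine ⟨fun z hz => Equiv.swap_apply_of_ne_of_ne ?_ ?_, ?_⟩
    · rintro rfl; exact hz h1
    · rintro rfl; exact hz h2
    · intro ι F hF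
      rw [pt_inner] at h1 h2
      have := frame_swap (ℓ := ℓ) b c (by omega) (by omega) (r - 2).toNat F 1 le_rfl (by omega)
        (fun i a ha ha' => hF i _ ((pt_box ..).2 (by omega)) (by cases b <;> simp [pt]))
        (fun i a ha ha' => hF i _ ((pt_box ..).2 (by omega)) (by cases b <;> simp [pt]))
      rwa [show (1 : ℤ) + ((r - 2).toNat : ℤ) + 1 = r by omega] at this
  | one => exact ⟨fun _ _ => rfl, fun ι F _ => Relation.ReflTransGen.refl⟩
  | mul g h _ _ ihg ihh =>
    refine ⟨fun z hz => ?_, fun ι F hF => ?_⟩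
    · rw [Equiv.Perm.mul_apply, ihh.1 z hz, ihg.1 z hz]
    · rw [← act_act]
      exact (ihg.2 ι F hF).trans (ihh.2 ι _ (framed_act hF ihg.1))
  | inv g _ ih =>
    have hf : ∀ z ∉ inner ℓ, g⁻¹ z = z := fun z hz => by
      rw [Equiv.Perm.inv_eq_iff_eq, ih.1 z hz]
    refine ⟨hf, fun ι F hF => ?_⟩
    have := ih.2 ι _ (framed_act hF hf)
    rw [act_act, inv_mul_cancel] at this
    exact eqv_symm this

lemma site_eq_pt (z : Site 2) : z = pt true (z 0) (z 1) := by
  funext i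
  fin_cases i <;> simp [pt]

lemma pt_flip (c r : ℤ) : pt true c r = pt false r c := by simp [pt]

lemma orbit_step {ℓ : ℕ} (b : Bool) (c r : ℤ) (h1 : pt b c r ∈ inner ℓ)
    (h2 : pt b (c + 1) r ∈ inner ℓ) :
    MulAction.orbit (Subgroup.closure (gens ℓ)) (pt b (c + 1) r) =
      MulAction.orbit (Subgroup.closure (gens ℓ)) (pt b c r) := by
  rw [MulAction.orbit_eq_iff]
  exact ⟨⟨Equiv.swap (pt b c r) (pt b (c + 1) r), Subgroup.subset_closure ⟨b, c, r, h1, h2, rfl⟩⟩,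
    Equiv.swap_apply_left _ _⟩

lemma orbit_line {ℓ : ℕ} (b : Bool) (r : ℤ) (hr : 2 ≤ r ∧ r ≤ ℓ) (n : ℕ) (hn : (n : ℤ) + 2 ≤ ℓ) :
    MulAction.orbit (Subgroup.closure (gens ℓ)) (pt b (n + 2) r) =
      MulAction.orbit (Subgroup.closure (gens ℓ)) (pt b 2 r) := by
  induction n with
  | zero => simp
  | succ n ih =>
    push_cast at *
    rw [← ih (by omega), show (n : ℤ) + 1 + 2 = n + 2 + 1 by ring]
    exact orbit_step _ _ _ ((pt_inner ..).2 (by omega)) ((pt_inner ..).2 (by omega))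

lemma orbit_all {ℓ : ℕ} (z : Site 2) (hz : z ∈ inner ℓ) :
    MulAction.orbit (Subgroup.closure (gens ℓ)) z =
      MulAction.orbit (Subgroup.closure (gens ℓ)) (pt true 2 2) := by
  have h0 := hz 0
  have h1 := hz 1
  rw [site_eq_pt z]
  have e1 := orbit_line (ℓ := ℓ) true (z 1) h1 (z 0 - 2).toNat (by omega)
  have e2 := orbit_line (ℓ := ℓ) false 2 (by omega) (z 1 - 2).toNat (by omega)
  rw [show ((z 0 - 2).toNat : ℤ) + 2 = z 0 by omega] at e1
  rw [show ((z 1 - 2).toNat : ℤ) + 2 = z 1 by omega] at e2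
  rw [e1, pt_flip, e2, pt_flip]

lemma inner_finite (ℓ : ℕ) : (inner ℓ).Finite := by
  refine (Set.finite_Icc (fun _ => 2 : Site 2) (fun _ => (ℓ : ℤ))).subset ?_
  intro z hz
  exact ⟨fun i => (hz i).1, fun i => (hz i).2⟩

lemma mem_gens_closure {ℓ : ℕ} (σ : Equiv.Perm (Site 2)) (h1 : ∀ x ∈ inner ℓ, σ x ∈ inner ℓ)
    (h2 : ∀ x ∉ inner ℓ, σ x = x) : σ ∈ Subgroup.closure (gens ℓ) := by
  rw [mem_closure_isSwap]
  · constructor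
    · refine (inner_finite ℓ).subset ?_
      intro z hz
      by_contra hcon
      exact hz (h2 z hcon)
    · intro x
      by_cases hx : x ∈ inner ℓ
      · rw [← MulAction.orbit_eq_iff, orbit_all _ (h1 x hx), orbit_all _ hx]
      · rw [h2 x hx]
        exact MulAction.mem_orbit_self x
  · rintro f ⟨b, c, r, -, -, rfl⟩
    exact ⟨_, _, by simp [pt_inj], rfl⟩

/-! ### From labelled paths to moves -/

lemma path_of_rtg {α : Type*} {R : α → α → Prop} {a b : α} (h : Relation.ReflTransGen R a b) :
    ∃ (T : ℕ) (f : ℕ → α), f 0 = a ∧ f T = b ∧ ∀ t < T, R (f t) (f (t + 1)) := by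
  induction h using Relation.ReflTransGen.head_induction_on with
  | refl => exact ⟨0, fun _ => b, rfl, rfl, fun t ht => absurd ht (Nat.not_lt_zero t)⟩
  | head hR hrest ih =>
    rename_i x y
    obtain ⟨T, f, f0, fT, hf⟩ := ih
    refine ⟨T + 1, fun t => Nat.casesOn t x f, rfl, fT, ?_⟩
    intro t ht
    cases t with
    | zero => simpa [f0] using hR
    | succ t => exact hf t (by omega)

lemma adj_mem_neighbors {x z : Site 2} (h : adj x z) : z ∈ neighbors x := by
  simp only [adj, Fin.sum_univ_two] at h
  have key : ∀ p : Fin 2 × Bool,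
      z = Function.update x p.1 (x p.1 + if p.2 then 1 else -1) → z ∈ neighbors x := by
    intro p hp
    exact Finset.mem_image.2 ⟨p, Finset.mem_univ _, hp.symm⟩
  have hcase : (z 0 = x 0 + 1 ∧ z 1 = x 1) ∨ (z 0 = x 0 - 1 ∧ z 1 = x 1) ∨
      (z 0 = x 0 ∧ z 1 = x 1 + 1) ∨ (z 0 = x 0 ∧ z 1 = x 1 - 1) := by
    rcases abs_cases (x 0 - z 0) with h0 | h0 <;> rcases abs_cases (x 1 - z 1) with h1 | h1 <;>
      omega
  rcases hcase with hc | hc | hc | hc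
  · refine key (0, true) ?_
    funext i; fin_cases i <;> simp [hc.1, hc.2]
  · refine key (0, false) ?_
    funext i; fin_cases i <;> simp [hc.1, hc.2, sub_eq_add_neg]
  · refine key (1, true) ?_
    funext i; fin_cases i <;> simp [hc.1, hc.2]
  · refine key (1, false) ?_
    funext i; fin_cases i <;> simp [hc.1, hc.2, sub_eq_add_neg]

/-- The unlabelled configuration of a labelled one. -/
def toConf (L : Lab) : Config 2 := fun z => (L z).isSome

lemma constraint_of {L : Lab} {x y : Site 2} (h1 : ∃ z, adj x z ∧ z ≠ y ∧ L z = none)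
    (h2 : ∃ z, adj y z ∧ z ≠ x ∧ L z = none) : constraint 2 (toConf L) x y := by
  obtain ⟨z, hz, hzy, hLz⟩ := h1
  obtain ⟨w, hw, hwx, hLw⟩ := h2
  constructor
  · exact Finset.card_pos.2 ⟨z, Finset.mem_filter.2 ⟨adj_mem_neighbors hz, hzy, by simp [toConf, hLz]⟩⟩
  · exact Finset.card_pos.2 ⟨w, Finset.mem_filter.2 ⟨adj_mem_neighbors hw, hwx, by simp [toConf, hLw]⟩⟩

/-- `w` is the only site carrying the label `l`. -/
def Carries (L : Lab) (l w : Site 2) : Prop := L w = some l ∧ ∀ v, L v = some l → v = w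

/-- The site carrying the label `l`. -/
def locate (L : Lab) (l : Site 2) : Site 2 := Classical.epsilon fun w => L w = some l

lemma Carries.locate_eq {L : Lab} {l w : Site 2} (h : Carries L l w) : locate L l = w :=
  h.2 _ (Classical.epsilon_spec (p := fun w => L w = some l) ⟨w, h.1⟩)

lemma Carries.step {L : Lab} {l w x y : Site 2} (h : Carries L l w) (hy : L y = none) :
    Carries (L ∘ Equiv.swap x y) l (if w = x then y else w) := by
  have hwy : w ≠ y := by
    rintro rfl
    have := h.1
    simp [hy] at this
  have e : (if w = x then y else w) = Equiv.swap x y w := by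
    rw [Equiv.swap_apply_def, if_neg hwy]
  rw [e]
  constructor
  · simpa using h.1
  · intro v hv
    rw [← h.2 _ hv, Equiv.swap_apply_self]

/-- The labelled configuration in which each particle carries its own position. -/
def lab0 (η : Config 2) : Lab := fun z => if η z = true then some z else none

lemma toConf_lab0 (η : Config 2) : toConf (lab0 η) = η := by
  funext z
  cases h : η z <;> simp [toConf, lab0, h]

lemma carries_lab0 {η : Config 2} {z : Site 2} (h : η z = true) : Carries (lab0 η) z z := by
  refine ⟨by simp [lab0, h], fun v hv => ?_⟩
  unfold lab0 at hv
  split_ifs at hv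
  simpa using hv

/-- (Permutation move, `k = d = 2`.) If `[ℓ]²` is framed and
`[2,ℓ]²` contains an empty site, any permutation `σ` of `[2,ℓ]²` can be realized
by a `T`-step move, the tracked particle ending at `σ z`. -/
theorem statement10 (ℓ : ℕ) (hℓ : 3 ≤ ℓ) (σ : Equiv.Perm (Site 2))
    (hσmid : ∀ x : Site 2, x ∈ {z : Site 2 | ∀ i, 2 ≤ z i ∧ z i ≤ (ℓ : ℤ)} →
      σ x ∈ {z : Site 2 | ∀ i, 2 ≤ z i ∧ z i ≤ (ℓ : ℤ)})
    (hσfix : ∀ x : Site 2, x ∉ {z : Site 2 | ∀ i, 2 ≤ z i ∧ z i ≤ (ℓ : ℤ)} → σ x = x) :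
    ∃ T : ℕ,
      ∃ mv : TStepMove 2 2
        {η | (∀ z ∈ box2 origin ℓ, (z 0 = 1 ∨ z 1 = 1) → η z = false) ∧
          ∃ z ∈ {z : Site 2 | ∀ i, 2 ≤ z i ∧ z i ≤ (ℓ : ℤ)}, η z = false}
        (box2 origin ℓ) T,
        ∀ η : Config 2,
          ((∀ z ∈ box2 origin ℓ, (z 0 = 1 ∨ z 1 = 1) → η z = false) ∧
            ∃ z ∈ {z : Site 2 | ∀ i, 2 ≤ z i ∧ z i ≤ (ℓ : ℤ)}, η z = false) →
          ∀ z : Site 2, η z = true →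
            (∀ x ∈ {z : Site 2 | ∀ i, 2 ≤ z i ∧ z i ≤ (ℓ : ℤ)}, mv.conf η T (σ x) = η x) ∧
            (∀ x ∉ box2 origin ℓ, mv.conf η T x = η x) ∧
            mv.pos η z T = σ z := by
  have hσ : ∀ x ∈ inner ℓ, σ x ∈ inner ℓ := hσmid
  have hσ' : ∀ x ∉ inner ℓ, σ x = x := hσfix
  set M : Set (Config 2) := {η | (∀ z ∈ box2 origin ℓ, (z 0 = 1 ∨ z 1 = 1) → η z = false) ∧
          ∃ z ∈ {z : Site 2 | ∀ i, 2 ≤ z i ∧ z i ≤ (ℓ : ℤ)}, η z = false} with hM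
  have hmem := (Subgroup.closure (gens ℓ)).inv_mem (mem_gens_closure σ hσ hσ')
  obtain ⟨hfix, hpath⟩ := gens_closure hmem
  have hfr : FramedF ℓ (fun i : M => lab0 i.1) := by
    intro i z hz hz1
    simp [lab0, i.2.1 z hz hz1]
  obtain ⟨T, f, f0, fT, hf⟩ := path_of_rtg (hpath M _ hfr)
  -- the family extended to all configurations
  let g : Config 2 → ℕ → Lab := fun η t => if h : η ∈ M then f t ⟨η, h⟩ else lab0 η
  have g0 : ∀ η ∈ M, g η 0 = lab0 η := by
    intro η h
    simp only [g, dif_pos h, f0]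
  have gT : ∀ η ∈ M, g η T = lab0 η ∘ (σ⁻¹ : Equiv.Perm (Site 2)) := by
    intro η h
    simp only [g, dif_pos h, fT]
    rfl
  have gs : ∀ η ∈ M, ∀ t < T, g η (t + 1) = g η t ∨ PStep ℓ (g η t) (g η (t + 1)) := by
    intro η h t ht
    simp only [g, dif_pos h]
    exact hf t ht ⟨η, h⟩
  have gc : ∀ η ∈ M, ∀ z, η z = true → ∀ t ≤ T, ∃ w, Carries (g η t) z w := by
    intro η h z hz t
    induction t with
    | zero =>
      intro _
      exact ⟨z, by rw [g0 η h]; exact carries_lab0 hz⟩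
    | succ t ih =>
      intro ht
      obtain ⟨w, hw⟩ := ih (by omega)
      rcases gs η h t (by omega) with e | ⟨x, y, -, -, -, -, hy, -, -, e⟩
      · exact ⟨w, by rw [e]; exact hw⟩
      · exact ⟨_, by rw [e]; exact hw.step hy⟩
  refine ⟨T, ⟨fun η t => toConf (g η t), fun η z t => locate (g η t) z, ?_, ?_, ?_⟩, ?_⟩
  · intro η h
    simp only [g0 η h, toConf_lab0]
  · intro η h z hz
    simp only [g0 η h]
    exact (carries_lab0 hz).locate_eq
  · intro η h z hz t ht
    obtain ⟨w, hw⟩ := gc η h z hz t (by omega)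
    rcases gs η h t ht with e | ⟨x, y, hxy, hx, hy, hLx, hLy, h1, h2, e⟩
    · left
      simp only [e, and_self]
    · right
      refine ⟨x, y, hxy, hx, hy, ?_, ?_, constraint_of h1 h2, ?_, ?_⟩
      · exact Option.isSome_iff_ne_none.2 hLx
      · simp [toConf, hLy]
      · funext u
        simp only [e, toConf, swap, Function.comp_apply, Equiv.swap_apply_def]
        split_ifs <;> rfl
      · simp only [e]
        rw [hw.locate_eq, (hw.step hLy).locate_eq]
  · intro η h z hz
    have h' : η ∈ M := h
    refine ⟨?_, ?_, ?_⟩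
    · intro x _
      have e : (σ⁻¹ : Equiv.Perm (Site 2)) (σ x) = x := by simp
      simp only [gT η h', toConf, Function.comp_apply, e]
      exact congrFun (toConf_lab0 η) x
    · intro x hx
      simp only [gT η h', toConf, Function.comp_apply]
      rw [hfix x]
      · exact congrFun (toConf_lab0 η) x
      · intro hin
        apply hx
        rw [site_eq_pt x, pt_box]
        have h0 := hin 0
        have h1 := hin 1
        omega
    · simp only [gT η h']
      apply Carries.locate_eq
      have hc := carries_lab0 hz
      refine ⟨by simpa using hc.1, fun v hv => ?_⟩
      have := hc.2 _ hv
      rw [← this]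
      simp

end KA
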